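/- The product ⊙• on A[τ] is commutative and associative: x ⊙• y = y ⊙• x and (x ⊙• y) ⊙• z = x ⊙• (y ⊙• z) for all x, y, z ∈ A[τ]. -/

import Mathlib

open Polynomial

/-- The product of coordinate vectors given by commutative structure constants is commutative. -/
theorem sum_structureConstants_comm {W R : Type*} [Fintype W] [CommRing R] (c : W → W → W → R)
    (hc : ∀ u v w, c u v w = c v u w) (x y : W → R) (w : W) :
    ∑ u, ∑ v, x u * y v * c u v w = ∑ u, ∑ v, y u * x v * c u v w := by
  rw [Finset.sum_comm]
  refine Finset.sum_congr rfl fun u _ => Finset.sum_congr rfl fun v _ => ?_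
  rw [hc v u w, mul_comm (x v)]

/-- The product of coordinate vectors given by associative structure constants is associative. -/
theorem sum_structureConstants_assoc {W R : Type*} [Fintype W] [CommRing R] (c : W → W → W → R)
    (hc : ∀ u v t w, ∑ s, c u v s * c s t w = ∑ s, c v t s * c u s w) (x y z : W → R) (w : W) :
    ∑ s, ∑ t, (∑ u, ∑ v, x u * y v * c u v s) * z t * c s t w =
      ∑ u, ∑ s, x u * (∑ v, ∑ t, y v * z t * c v t s) * c u s w := by
  have hl : ∑ s, ∑ t, (∑ u, ∑ v, x u * y v * c u v s) * z t * c s t w =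
      ∑ u, ∑ v, ∑ t, x u * y v * z t * ∑ s, c u v s * c s t w := by
    simp only [Finset.sum_mul, Finset.mul_sum]
    calc _ = ∑ s, ∑ u, ∑ v, ∑ t, x u * y v * c u v s * z t * c s t w := by
          refine Finset.sum_congr rfl fun s _ => ?_
          rw [Finset.sum_comm]
          exact Finset.sum_congr rfl fun u _ => Finset.sum_comm
      _ = _ := by
          rw [Finset.sum_comm]
          refine Finset.sum_congr rfl fun u _ => ?_
          rw [Finset.sum_comm]
          refine Finset.sum_congr rfl fun v _ => ?_
          rw [Finset.sum_comm]
          exact Finset.sum_congr rfl fun t _ => Finset.sum_congr rfl fun s _ => by ring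
  have hr : ∑ u, ∑ s, x u * (∑ v, ∑ t, y v * z t * c v t s) * c u s w =
      ∑ u, ∑ v, ∑ t, x u * y v * z t * ∑ s, c v t s * c u s w := by
    simp only [Finset.sum_mul, Finset.mul_sum]
    refine Finset.sum_congr rfl fun u _ => ?_
    rw [Finset.sum_comm]
    refine Finset.sum_congr rfl fun v _ => ?_
    rw [Finset.sum_comm]
    exact Finset.sum_congr rfl fun t _ => Finset.sum_congr rfl fun s _ => by ring
  rw [hl, hr]
  simp only [hc]

/-- Monomials with integer exponents multiply as expected when each exponent is nonnegative
unless its coefficient vanishes. -/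
theorem C_mul_X_pow_toNat_mul {a b : ℤ} {m n : ℤ} (hm : a ≠ 0 → 0 ≤ m) (hn : b ≠ 0 → 0 ≤ n) :
    (C a * X ^ m.toNat) * (C b * X ^ n.toNat) = C (a * b) * (X : ℤ[X]) ^ (m + n).toNat := by
  by_cases ha : a = 0
  · simp [ha]
  by_cases hb : b = 0
  · simp [hb]
  rw [Int.toNat_add (hm ha) (hn hb), pow_add, C_mul]
  ring

theorem structureConstants_comm {W A : Type*} [Fintype W] [CommRing A]
    (e : Module.Basis W ℤ A) {d : W → W → W → ℤ}
    (hd : ∀ u v : W, e u * e v = ∑ w, d u v w • e w) (u v w : W) : d u v w = d v u w := by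
  have h : ∑ w, d u v w • e w = ∑ w, d v u w • e w := by rw [← hd, ← hd, mul_comm]
  simpa only [e.repr_sum_self] using congrFun (congrArg (fun a => ⇑(e.repr a)) h) w

theorem structureConstants_assoc {W A : Type*} [Fintype W] [CommRing A]
    (e : Module.Basis W ℤ A) {d : W → W → W → ℤ}
    (hd : ∀ u v : W, e u * e v = ∑ w, d u v w • e w) (u v t w : W) :
    ∑ s, d u v s * d s t w = ∑ s, d v t s * d u s w := by
  have hl : e u * e v * e t = ∑ w, (∑ s, d u v s * d s t w) • e w := by
    simp only [hd, Finset.sum_mul, smul_mul_assoc, Finset.smul_sum, Finset.sum_smul, mul_smul]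
    exact Finset.sum_comm
  have hr : e u * (e v * e t) = ∑ w, (∑ s, d v t s * d u s w) • e w := by
    simp only [hd, Finset.mul_sum, mul_smul_comm, Finset.smul_sum, Finset.sum_smul, mul_smul]
    exact Finset.sum_comm
  have h := hl.symm.trans ((mul_assoc _ _ _).trans hr)
  simpa only [e.repr_sum_self] using congrFun (congrArg (fun a => ⇑(e.repr a)) h) w

/-- The product `⊙•` on `A[τ]` (modelled as `W → ℤ[τ]`, the coordinates on the
basis `(e_w)`) is commutative and associative. -/
theorem bk_tau_product_comm_assoc
    {W : Type*} [Fintype W] {A : Type*} [CommRing A]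
    (e : Module.Basis W ℤ A) (d : W → W → W → ℤ)
    (hd : ∀ u v : W, e u * e v = ∑ w, d u v w • e w)
    (χ : W → ℤ)
    (hχ : ∀ u v w : W, d u v w ≠ 0 → χ u + χ v ≤ χ w)
    (odot : (W → Polynomial ℤ) → (W → Polynomial ℤ) → (W → Polynomial ℤ))
    (hodot : ∀ (x y : W → Polynomial ℤ) (w : W), odot x y w =
      ∑ u, ∑ v, x u * y v *
        (Polynomial.C (d u v w) * Polynomial.X ^ (χ w - χ u - χ v).toNat)) :
    (∀ x y : W → Polynomial ℤ, odot x y = odot y x) ∧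
    (∀ x y z : W → Polynomial ℤ, odot (odot x y) z = odot x (odot y z)) := by
  have h_nonneg (u v w : W) (h : d u v w ≠ 0) : 0 ≤ χ w - χ u - χ v := by
    linarith [hχ u v w h]
  constructor
  · intro x y
    funext w
    rw [hodot, hodot]
    refine sum_structureConstants_comm
      (fun u v w => C (d u v w) * X ^ (χ w - χ u - χ v).toNat) (fun u v w => ?_) x y w
    simp only [structureConstants_comm e hd u v w, sub_right_comm (χ w) (χ u)]
  · intro x y z
    funext w
    simp only [hodot]
    refine sum_structureConstants_assoc
      (fun u v w => C (d u v w) * X ^ (χ w - χ u - χ v).toNat) (fun u v t w => ?_) x y z w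
    have hl (s : W) : χ s - χ u - χ v + (χ w - χ s - χ t) = χ w - χ u - χ v - χ t := by ring
    have hr (s : W) : χ s - χ v - χ t + (χ w - χ u - χ s) = χ w - χ u - χ v - χ t := by ring
    simp only [C_mul_X_pow_toNat_mul (h_nonneg _ _ _) (h_nonneg _ _ _), hl, hr,
      ← Finset.sum_mul, ← map_sum, structureConstants_assoc e hd]
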